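/- Let n ≥ 1, d1, d2 ≥ 1, T = d1 + d2 − 1 and D = max(d1, d2). Let H be a (d1·n)×(d2·n) real block Hankel matrix with n×n blocks H_1,…,H_T (the (i,j)-th block of H is H_{i+j−1}). Suppose H admits a square extension: a (D·n)×(D·n) block Hankel matrix H□ with n×n blocks whose first T block anti-diagonals coincide with H_1,…,H_T, such that H□ is positive semidefinite of rank r, its first block H_1 has rank r, and at least one other block H_j with j > 1 has rank r. Then there exist a real n×r matrix Y and a symmetric real r×r matrix M with rank(H) = rank(Y) = rank(M) = r such that H_k = Y M^{k−1} Y* for every k ∈ [T]; equivalently, H = H(YY* , YMY* , …, YM^{T−1}Y*). -/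

import Mathlib

noncomputable section

open Matrix

theorem Matrix.PosSemidef.exists_eq_mul_transpose_of_rank_eq {ι : Type*} [Fintype ι]
    {A : Matrix ι ι ℝ} (hA : A.PosSemidef) {r : ℕ} (hr : A.rank = r) :
    ∃ Z : Matrix ι (Fin r) ℝ, A = Z * Zᵀ := by
  classical
  have hH := hA.isHermitian
  rw [hH.rank_eq_card_non_zero_eigs] at hr
  let e := Fintype.equivFinOfCardEq hr
  let U : Matrix ι ι ℝ := hH.eigenvectorUnitary
  have hspec : A = U * Matrix.diagonal hH.eigenvalues * Uᵀ := by
    conv_lhs => rw [hH.spectral_theorem, Unitary.conjStarAlgAut_apply]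
    rfl
  refine ⟨Matrix.of fun i a => U i (e.symm a) * √(hH.eigenvalues (e.symm a)), ?_⟩
  ext i j
  have hsum := Fintype.sum_subtype_add_sum_subtype (fun k => hH.eigenvalues k ≠ 0)
    fun k => U i k * hH.eigenvalues k * U j k
  have hzero : ∑ k : {k // ¬ hH.eigenvalues k ≠ 0}, U i k * hH.eigenvalues k * U j k = 0 :=
    Finset.sum_eq_zero fun k _ => by rw [not_not.mp k.2, mul_zero, zero_mul]
  rw [hzero, add_zero, ← e.symm.sum_comp] at hsum
  conv_lhs => rw [hspec]
  rw [Matrix.mul_apply, Matrix.mul_apply]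
  simp only [Matrix.mul_diagonal, Matrix.transpose_apply, Matrix.of_apply]
  rw [← hsum]
  refine Finset.sum_congr rfl fun a _ => ?_
  have hs := Real.mul_self_sqrt (hA.eigenvalues_nonneg (e.symm a))
  linear_combination (-U i (e.symm a) * U j (e.symm a)) * hs

theorem Matrix.exists_left_inverse_of_rank_eq_card {m ι : Type*} [Fintype m] [Fintype ι]
    [DecidableEq ι] {Y : Matrix m ι ℝ} (hY : Y.rank = Fintype.card ι) :
    ∃ L : Matrix ι m ℝ, L * Y = 1 := by
  have hu : IsUnit (Yᵀ * Y) := by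
    rw [← Matrix.mulVec_surjective_iff_isUnit]
    change Function.Surjective (Yᵀ * Y).mulVecLin
    rw [← LinearMap.range_eq_top]
    refine Submodule.eq_top_of_finrank_eq ?_
    rw [Module.finrank_pi, ← hY, ← Matrix.rank_transpose_mul_self Y]
    rfl
  refine ⟨(Yᵀ * Y)⁻¹ * Yᵀ, ?_⟩
  rw [Matrix.mul_assoc, Matrix.nonsing_inv_mul _ ((Matrix.isUnit_iff_isUnit_det _).mp hu)]

/-- If the products `Z i * (Z j)ᵀ` depend only on `i + j` and `Z 0` has full column rank, then the
`Z i` are the images of `Z 0` under the powers of a symmetric matrix. -/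
theorem Matrix.exists_isSymm_eq_mul_pow {m ι : Type*} [Fintype m] [Fintype ι] [DecidableEq ι]
    {D : ℕ} (hD : 2 ≤ D) (K : ℕ → Matrix m m ℝ) (Z : ℕ → Matrix m ι ℝ)
    (hK : ∀ i < D, ∀ j < D, K (i + j) = Z i * (Z j)ᵀ) (hZ : (Z 0).rank = Fintype.card ι) :
    ∃ M : Matrix ι ι ℝ, M.IsSymm ∧ ∀ i < D, Z i = Z 0 * M ^ i := by
  obtain ⟨L, hL⟩ := Matrix.exists_left_inverse_of_rank_eq_card hZ
  have hcancel : ∀ A B : Matrix ι m ℝ, Z 0 * A = Z 0 * B → A = B := fun A B h => by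
    simpa [← Matrix.mul_assoc, hL] using congrArg (L * ·) h
  have hshift : ∀ j, j + 1 < D → Z 0 * (Z (j + 1))ᵀ = Z 1 * (Z j)ᵀ := fun j hj => by
    rw [← hK 0 (by omega) (j + 1) hj, ← hK 1 (by omega) j (by omega)]
    congr 1
    omega
  have h01 := hshift 0 (by omega)
  have hZ1 : (Z 1)ᵀ = L * Z 1 * (Z 0)ᵀ := by
    rw [Matrix.mul_assoc, ← h01, ← Matrix.mul_assoc, hL, Matrix.one_mul]
  have hLT : (Z 0)ᵀ * Lᵀ = 1 := by rw [← Matrix.transpose_mul, hL, Matrix.transpose_one]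
  have hsymm : (L * Z 1).IsSymm := by
    rw [Matrix.IsSymm, Matrix.transpose_mul, hZ1, Matrix.mul_assoc, hLT, Matrix.mul_one]
  have hZ1' : Z 1 = Z 0 * (L * Z 1) := by
    have h := congrArg Matrix.transpose hZ1
    rwa [Matrix.transpose_mul, hsymm.eq, Matrix.transpose_transpose,
      Matrix.transpose_transpose] at h
  refine ⟨L * Z 1, hsymm, fun i => ?_⟩
  induction i with
  | zero => simp
  | succ j ih =>
    intro hj
    have h := hshift j hj
    nth_rewrite 1 [hZ1'] at h
    rw [Matrix.mul_assoc] at h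
    have h' := congrArg Matrix.transpose (hcancel _ _ h)
    rw [Matrix.transpose_mul, hsymm.eq, Matrix.transpose_transpose,
      Matrix.transpose_transpose] at h'
    rw [h', ih (by omega), pow_succ, Matrix.mul_assoc]

/-- The block Hankel operator. -/
def blockHankel (n d1 d2 T : ℕ) (X : Fin T → Matrix (Fin n) (Fin n) ℝ) :
    Matrix (Fin d1 × Fin n) (Fin d2 × Fin n) ℝ :=
  Matrix.of fun p q =>
    if h : p.1.val + q.1.val < T then X ⟨p.1.val + q.1.val, h⟩ p.2 q.2 else 0

/-- If a block Hankel matrix with blocks `H_1, …, H_T` admits a positive semidefinite square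
extension (a `(D·n)×(D·n)` block Hankel matrix with blocks `K_1, …, K_{2D−1}`, `K_k = H_k`
for `k ≤ T`) of rank `r`, whose first block has rank `r` and at least one other block has
rank `r`, then there are `Y ∈ ℝ^{n×r}` and symmetric `M ∈ ℝ^{r×r}` with
`rank(H) = rank(Y) = rank(M) = r` and `H_k = Y M^{k−1} Y*` for all `k ∈ [T]`. -/
theorem blockHankel_psd_extension_factorization (n d1 d2 T D r : ℕ)
    (hn : 1 ≤ n) (hd1 : 1 ≤ d1) (hd2 : 1 ≤ d2)
    (hT : T = d1 + d2 - 1) (hD : D = max d1 d2)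
    (Hb : Fin T → Matrix (Fin n) (Fin n) ℝ)
    (K : Fin (2 * D - 1) → Matrix (Fin n) (Fin n) ℝ)
    (hext : ∀ k : Fin T, K ⟨k.val, by
        have h1 := le_max_left d1 d2
        have h2 := le_max_right d1 d2
        have h3 := k.isLt
        omega⟩ = Hb k)
    (hpsd : (blockHankel n D D (2 * D - 1) K).PosSemidef)
    (hrank : (blockHankel n D D (2 * D - 1) K).rank = r)
    (hfirst : (K ⟨0, by
        have h1 := le_max_left d1 d2
        omega⟩).rank = r)
    (hother : ∃ j : Fin (2 * D - 1), 0 < j.val ∧ (K j).rank = r) :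
    ∃ (Y : Matrix (Fin n) (Fin r) ℝ) (M : Matrix (Fin r) (Fin r) ℝ),
      M.IsSymm ∧ (blockHankel n d1 d2 T Hb).rank = r ∧ Y.rank = r ∧ M.rank = r ∧
        ∀ k : Fin T, Hb k = Y * M ^ k.val * Yᵀ := by
  have hT' : T ≤ 2 * D - 1 := by omega
  obtain ⟨j, hj, hjr⟩ := hother
  have hD2 : 2 ≤ D := by have := j.isLt; omega
  obtain ⟨Z, hZ⟩ := hpsd.exists_eq_mul_transpose_of_rank_eq hrank
  let Kn : ℕ → Matrix (Fin n) (Fin n) ℝ := fun k => if h : k < 2 * D - 1 then K ⟨k, h⟩ else 0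
  let Zn : ℕ → Matrix (Fin n) (Fin r) ℝ := fun k =>
    if h : k < D then Z.submatrix (fun a => (⟨k, h⟩, a)) id else 0
  have hKn : ∀ k : Fin (2 * D - 1), K k = Kn k := fun k => by simp [Kn]
  have hHb : ∀ k : Fin T, Hb k = Kn k := fun k => by rw [← hext k, hKn]
  have hKZ : ∀ i < D, ∀ j < D, Kn (i + j) = Zn i * (Zn j)ᵀ := by
    intro i hi j hj
    ext a b
    have h := congrFun (congrFun hZ (⟨i, hi⟩, a)) (⟨j, hj⟩, b)
    have hij : i + j < 2 * D - 1 := by omega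
    simpa [blockHankel, hij, Kn, Zn, hi, hj, Matrix.mul_apply] using h
  have hZ0 : (Zn 0).rank = r := by
    rw [← Matrix.rank_self_mul_transpose, ← hKZ 0 (by omega) 0 (by omega), ← hfirst, hKn]
  obtain ⟨M, hM, hpow⟩ := Matrix.exists_isSymm_eq_mul_pow hD2 Kn Zn hKZ (by simpa using hZ0)
  have hfac : ∀ k < 2 * D - 1, Kn k = Zn 0 * M ^ k * (Zn 0)ᵀ := by
    intro k hk
    obtain ⟨p, q, hp, hq, rfl⟩ : ∃ p q, p < D ∧ q < D ∧ k = p + q :=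
      ⟨min k (D - 1), k - min k (D - 1), by omega, by omega, by omega⟩
    rw [hKZ p hp q hq, hpow p hp, hpow q hq, Matrix.transpose_mul, (hM.pow q).eq, pow_add]
    simp only [Matrix.mul_assoc]
  refine ⟨Zn 0, M, hM, le_antisymm ?_ ?_, hZ0, le_antisymm (Matrix.rank_le_width M) ?_,
    fun k => by rw [hHb, hfac k (by omega)]⟩
  · have hsub : blockHankel n d1 d2 T Hb = (blockHankel n D D (2 * D - 1) K).submatrix
        (Prod.map (Fin.castLE (by omega)) id) (Prod.map (Fin.castLE (by omega)) id) := by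
      ext p q
      have h1 : p.1.val + q.1.val < T := by omega
      have h2 : p.1.val + q.1.val < 2 * D - 1 := by omega
      simp [blockHankel, h1, h2, hHb, hKn]
    rw [hsub]
    exact (Matrix.rank_submatrix_le _ _ _).trans_eq hrank
  · have hsub : Kn 0 = (blockHankel n d1 d2 T Hb).submatrix
        (fun a => (⟨0, hd1⟩, a)) (fun a => (⟨0, hd2⟩, a)) := by
      ext a b
      have h0 : 0 < T := by omega
      simp [blockHankel, h0, hHb]
    calc r = (Kn 0).rank := by rw [← hfirst, hKn]
      _ ≤ _ := by rw [hsub]; exact Matrix.rank_submatrix_le _ _ _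
  · refine hjr.symm.le.trans ?_
    obtain ⟨i, hi⟩ := Nat.exists_eq_succ_of_ne_zero hj.ne'
    rw [hKn, hfac j j.isLt, hi, pow_succ, ← Matrix.mul_assoc]
    exact (Matrix.rank_mul_le_left _ _).trans (Matrix.rank_mul_le_right _ _)

end
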